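/- Let m ≥ 1 be an integer and α, δ ∈ (0,1). Set ε = sqrt(ln(2/δ)/(2m)) and let j ∈ {1,…,m} satisfy 1 − α + ε ≤ j/m ≤ 1 − α + ε + 1/m. Let U_1, …, U_m be the coordinate maps on the product space ([0,1]^m, λ^{⊗m}) where λ is the Lebesgue (uniform) measure on [0,1], and let U_{(j)} denote the j-th order statistic. Then λ^{⊗m}({u ∈ [0,1]^m : U_{(j)}(u) ≤ 1 − α}) ≤ κ^DKW_{α,δ}. -/

import Mathlib

open MeasureTheory

/-- `Δ_m^DKW = sqrt(2 ln(2/δ)/(9m)) + 1/(3m)`. -/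
noncomputable def deltaDKW (m : ℕ) (δ : ℝ) : ℝ :=
  Real.sqrt (2 * Real.log (2 / δ) / (9 * m)) + 1 / (3 * m)

/-- The piecewise constant `κ^DKW_{α,δ}` from Theorem 2. -/
noncomputable def kappaDKW (m : ℕ) (α δ : ℝ) : ℝ :=
  if α ≤ 1 / 2 then (δ / 2) ^ ((4 * α * (1 - α))⁻¹)
  else if α ≤ 1 / 2 + deltaDKW m δ then δ / 2
  else (δ / 2) ^ ((4 * (α - deltaDKW m δ) * (1 - α + deltaDKW m δ))⁻¹)

/-- The `j`-th order statistic (`j : Fin m`, zero-based) of `s : Fin m → ℝ`. -/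
noncomputable def orderStat {m : ℕ} (s : Fin m → ℝ) (j : Fin m) : ℝ :=
  (s ∘ Tuple.sort s) j

/-- The relative entropy of the Bernoulli law of parameter `x` with respect to that of
parameter `p`. -/
noncomputable def bernoulliEntropy (p x : ℝ) : ℝ :=
  x * (Real.log x - Real.log p) + (1 - x) * (Real.log (1 - x) - Real.log (1 - p))

/-- Tangent-line bound for the convex function `1 / x` at `c`. -/
lemma tangent_le_inv {x c : ℝ} (hx : 0 < x) (hc : 0 < c) :
    1 / c - (x - c) / c ^ 2 ≤ 1 / x := by
  have h : 1 / x - (1 / c - (x - c) / c ^ 2) = (x - c) ^ 2 / (x * c ^ 2) := by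
    field_simp
    ring
  have : 0 ≤ (x - c) ^ 2 / (x * c ^ 2) := by positivity
  linarith

/-- A function whose value at `a` and derivative on `[a, b]` are nonnegative is nonnegative
on `[a, b]`. -/
lemma nonneg_of_hasDerivAt_nonneg {a b : ℝ} {f f' : ℝ → ℝ} (ha : 0 ≤ f a)
    (hf : ∀ x ∈ Set.Icc a b, HasDerivAt f (f' x) x) (hf' : ∀ x ∈ Set.Icc a b, 0 ≤ f' x) :
    ∀ x ∈ Set.Icc a b, 0 ≤ f x := by
  intro x hx
  have hmono : MonotoneOn f (Set.Icc a b) := by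
    apply monotoneOn_of_deriv_nonneg (convex_Icc a b)
    · exact fun y hy => (hf y hy).continuousAt.continuousWithinAt
    · exact fun y hy => (hf y (interior_subset hy)).differentiableAt.differentiableWithinAt
    · intro y hy
      rw [(hf y (interior_subset hy)).deriv]
      exact hf' y (interior_subset hy)
  exact ha.trans (hmono ⟨le_rfl, hx.1.trans hx.2⟩ hx hx.1)

/-- Sub-Gaussian lower bound on the Bernoulli relative entropy, with the variance evaluated
one third of the way from `p` to `p + t`. -/
lemma sq_div_le_bernoulliEntropy {p t : ℝ} (hp : 0 < p) (ht : 0 ≤ t) (hpt : p + t < 1) :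
    t ^ 2 / (2 * ((p + t / 3) * (1 - (p + t / 3)))) ≤ bernoulliEntropy p (p + t) := by
  set c := p + t / 3 with hc
  have hc0 : 0 < c := by linarith
  have hc1 : 0 < 1 - c := by linarith
  set A := 1 / c + 1 / (1 - c) with hA
  set B := 1 / c ^ 2 - 1 / (1 - c) ^ 2 with hB
  have hderiv : ∀ x ∈ Set.Icc p (p + t),
      0 ≤ Real.log x - Real.log p - (Real.log (1 - x) - Real.log (1 - p))
        - (A * (x - p) - B * ((x - p) ^ 2 / 2 - t / 3 * (x - p))) := by
    apply nonneg_of_hasDerivAt_nonneg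
      (f' := fun x => 1 / x + 1 / (1 - x) - (A - B * (x - c)))
    · simp
    · intro x hx
      have hx0 : x ≠ 0 := by linarith [hx.1]
      have hx1 : 1 - x ≠ 0 := by linarith [hx.2]
      have h1 := (Real.hasDerivAt_log hx0).sub_const (Real.log p)
      have h2 := (((hasDerivAt_id x).const_sub 1).log hx1).sub_const (Real.log (1 - p))
      have h3 := (hasDerivAt_id x).sub_const p
      have h4 := (h3.const_mul A).sub
        ((((h3.pow 2).div_const 2).sub (h3.const_mul (t / 3))).const_mul B)
      refine ((h1.sub h2).sub h4).congr_deriv ?_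
      simp only [id, hc]
      push_cast
      ring
    · intro x hx
      have h1 := tangent_le_inv (x := x) (by linarith [hx.1]) hc0
      have h2 := tangent_le_inv (x := 1 - x) (by linarith [hx.2]) hc1
      have h3 : A - B * (x - c) = (1 / c - (x - c) / c ^ 2)
          + (1 / (1 - c) - ((1 - x) - (1 - c)) / (1 - c) ^ 2) := by
        rw [hA, hB]
        ring
      linarith
  have hmain : ∀ x ∈ Set.Icc p (p + t),
      0 ≤ bernoulliEntropy p x
        - (A * (x - p) ^ 2 / 2 - B * ((x - p) ^ 3 / 6 - t / 3 * (x - p) ^ 2 / 2)) := by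
    refine nonneg_of_hasDerivAt_nonneg ?_ ?_ hderiv
    · simp [bernoulliEntropy]
    · intro x hx
      have hx0 : x ≠ 0 := by linarith [hx.1]
      have hx1 : 1 - x ≠ 0 := by linarith [hx.2]
      have h0 := (hasDerivAt_id x).const_sub 1
      have h1 := (hasDerivAt_id x).mul ((Real.hasDerivAt_log hx0).sub_const (Real.log p))
      have h2 := h0.mul ((h0.log hx1).sub_const (Real.log (1 - p)))
      have h3 := (hasDerivAt_id x).sub_const p
      have h4 := (((h3.pow 2).const_mul A).div_const 2).sub
        ((((h3.pow 3).div_const 6).sub (((h3.pow 2).const_mul (t / 3)).div_const 2)).const_mul B)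
      refine ((h1.add h2).sub h4).congr_deriv ?_
      simp only [id]
      push_cast
      field_simp
      ring
  have h := hmain (p + t) ⟨by linarith, le_rfl⟩
  have hval : A * (p + t - p) ^ 2 / 2
      - B * ((p + t - p) ^ 3 / 6 - t / 3 * (p + t - p) ^ 2 / 2)
      = t ^ 2 / (2 * (c * (1 - c))) := by
    rw [hA]
    field_simp
    ring
  linarith

/-- If the `j`-th order statistic is at most `p`, then more than `j` entries are at most `p`. -/
lemma lt_card_of_orderStat_le {m : ℕ} {v : Fin m → ℝ} {j : Fin m} {p : ℝ}
    (h : orderStat v j ≤ p) : (j : ℕ) < (Finset.univ.filter fun i => v i ≤ p).card := by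
  have hsub : (Finset.Iic j).map (Tuple.sort v).toEmbedding
      ⊆ Finset.univ.filter fun i => v i ≤ p := by
    intro i hi
    obtain ⟨k, hk, rfl⟩ := Finset.mem_map.mp hi
    simpa using (Tuple.monotone_sort v (Finset.mem_Iic.mp hk)).trans h
  have := Finset.card_le_card hsub
  rw [Finset.card_map, Fin.card_Iic] at this
  omega

/-- Chernoff's method for the number of uniform variables that are at most `p`. -/
lemma measure_orderStat_le_pow_div {m : ℕ} (j : Fin m) {p w : ℝ} (hp0 : 0 ≤ p) (hp1 : p ≤ 1)
    (hw : 1 ≤ w) :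
    (Measure.pi fun _ : Fin m => volume.restrict (Set.Icc (0 : ℝ) 1))
        {v : Fin m → ℝ | orderStat v j ≤ p}
      ≤ ENNReal.ofReal ((w * p + (1 - p)) ^ m / w ^ ((j : ℕ) + 1)) := by
  have hw0 : 0 < w := by linarith
  let g : ℝ → ENNReal := fun x => if x ≤ p then ENNReal.ofReal w else 1
  have hg : Measurable g := Measurable.ite measurableSet_Iic measurable_const measurable_const
  have : IsProbabilityMeasure (volume.restrict (Set.Icc (0 : ℝ) 1)) := ⟨by simp⟩
  have hint : ∫⁻ x, g x ∂(volume.restrict (Set.Icc (0 : ℝ) 1))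
      = ENNReal.ofReal (w * p + (1 - p)) := by
    have hsplit : g = (Set.Iic p).piecewise (fun _ => ENNReal.ofReal w) (fun _ => 1) := by
      ext x
      simp [g, Set.piecewise]
    have hIcc : Set.Iic p ∩ Set.Icc 0 1 = Set.Icc 0 p := by
      ext x
      simp only [Set.mem_inter_iff, Set.mem_Iic, Set.mem_Icc]
      constructor
      · exact fun h => ⟨h.2.1, h.1⟩
      · exact fun h => ⟨h.2, h.1, h.2.trans hp1⟩
    have hIoc : (Set.Iic p)ᶜ ∩ Set.Icc 0 1 = Set.Ioc p 1 := by
      ext x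
      simp only [Set.mem_inter_iff, Set.mem_compl_iff, Set.mem_Iic, Set.mem_Icc, not_le,
        Set.mem_Ioc]
      constructor
      · exact fun h => ⟨h.1, h.2.2⟩
      · exact fun h => ⟨h.1, hp0.trans h.1.le, h.2⟩
    rw [hsplit, lintegral_piecewise measurableSet_Iic, setLIntegral_const, setLIntegral_const,
      Measure.restrict_apply measurableSet_Iic, Measure.restrict_apply measurableSet_Iic.compl,
      hIcc, hIoc, Real.volume_Icc, Real.volume_Ioc, one_mul, sub_zero,
      ← ENNReal.ofReal_mul hw0.le, ← ENNReal.ofReal_add (by positivity) (by linarith)]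
  have hprod : ∫⁻ v : Fin m → ℝ, ∏ i, g (v i)
        ∂(Measure.pi fun _ : Fin m => volume.restrict (Set.Icc (0 : ℝ) 1))
      = ENNReal.ofReal ((w * p + (1 - p)) ^ m) := by
    rw [ProbabilityTheory.lintegral_prod_eq_prod_lintegral_of_indepFun Finset.univ
      (fun i (v : Fin m → ℝ) => g (v i))
      (ProbabilityTheory.iIndepFun_pi fun _ => hg.aemeasurable)
      (fun i => hg.comp (measurable_pi_apply i))]
    simp_rw [fun i : Fin m => (measurePreserving_eval
      (fun _ : Fin m => volume.restrict (Set.Icc (0 : ℝ) 1)) i).lintegral_comp hg, hint]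
    rw [Finset.prod_const, Finset.card_univ, Fintype.card_fin,
      ENNReal.ofReal_pow (by nlinarith)]
  have hle : ∀ v : Fin m → ℝ, orderStat v j ≤ p →
      ENNReal.ofReal (w ^ ((j : ℕ) + 1)) ≤ ∏ i, g (v i) := by
    intro v hv
    rw [Finset.prod_ite, Finset.prod_const, Finset.prod_const_one, mul_one,
      ENNReal.ofReal_pow hw0.le]
    exact pow_le_pow_right₀ (by simpa using hw) (lt_card_of_orderStat_le hv)
  have hmeas : Measurable fun v : Fin m → ℝ => ∏ i, g (v i) :=
    Finset.measurable_prod _ fun i _ => hg.comp (measurable_pi_apply i)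
  rw [ENNReal.ofReal_div_of_pos (pow_pos hw0 _), ← hprod]
  exact (measure_mono hle).trans (meas_ge_le_lintegral_div hmeas.aemeasurable
    (by simpa using pow_pos hw0 _) ENNReal.ofReal_ne_top)

/-- The Chernoff bound for uniform order statistics in relative-entropy form. -/
lemma measure_orderStat_le_exp_bernoulliEntropy {m : ℕ} (j : Fin m) {p x : ℝ} (hp : 0 < p)
    (hpx : p ≤ x) (hx1 : x < 1) (hxj : m * x ≤ ((j : ℕ) + 1 : ℝ)) :
    (Measure.pi fun _ : Fin m => volume.restrict (Set.Icc (0 : ℝ) 1))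
        {v : Fin m → ℝ | orderStat v j ≤ p}
      ≤ ENNReal.ofReal (Real.exp (-(m * bernoulliEntropy p x))) := by
  have hx0 : 0 < x := hp.trans_le hpx
  have hq : 0 < 1 - p := by linarith
  have hy : 0 < 1 - x := by linarith
  set w := x * (1 - p) / (p * (1 - x)) with hw_def
  have hw : 1 ≤ w := by
    rw [hw_def, one_le_div (by positivity)]
    nlinarith
  have hw0 : 0 < w := by linarith
  refine (measure_orderStat_le_pow_div j hp.le (by linarith) hw).trans
    (ENNReal.ofReal_le_ofReal ?_)
  have hbase : w * p + (1 - p) = (1 - p) / (1 - x) := by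
    rw [hw_def]
    field_simp
    ring
  have hlogw : Real.log w
      = Real.log x + Real.log (1 - p) - (Real.log p + Real.log (1 - x)) := by
    rw [hw_def, Real.log_div (by positivity) (by positivity), Real.log_mul hx0.ne' hq.ne',
      Real.log_mul hp.ne' hy.ne']
  rw [hbase, ← Real.log_le_iff_le_exp (by positivity), Real.log_div (by positivity)
    (by positivity), Real.log_pow, Real.log_pow, Real.log_div hq.ne' hy.ne']
  have hmul := mul_le_mul_of_nonneg_right hxj (Real.log_nonneg hw)
  push_cast
  have hent : m * bernoulliEntropy p x
      = m * x * Real.log w - m * (Real.log (1 - p) - Real.log (1 - x)) := by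
    rw [hlogw, bernoulliEntropy]
    ring
  linarith

/-- Sub-Gaussian tail bound for uniform order statistics. -/
lemma measure_orderStat_le_exp_sq {m : ℕ} (j : Fin m) {p t : ℝ} (hp : 0 < p) (ht : 0 < t)
    (htj : m * (p + t) ≤ ((j : ℕ) + 1 : ℝ)) :
    (Measure.pi fun _ : Fin m => volume.restrict (Set.Icc (0 : ℝ) 1))
        {v : Fin m → ℝ | orderStat v j ≤ p}
      ≤ ENNReal.ofReal
          (Real.exp (-(m * (t ^ 2 / (2 * ((p + t / 3) * (1 - (p + t / 3)))))))) := by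
  have hjm : ((j : ℕ) + 1 : ℝ) ≤ m := by exact_mod_cast j.isLt
  have hm : 0 < (m : ℝ) := by
    have : (0 : ℝ) ≤ (j : ℕ) := Nat.cast_nonneg _
    linarith
  have hpt : p + t ≤ 1 := le_of_mul_le_mul_left (by linarith) hm
  have hcont : ContinuousAt (fun s : ℝ => ENNReal.ofReal
      (Real.exp (-(m * (s ^ 2 / (2 * ((p + s / 3) * (1 - (p + s / 3))))))))) t := by
    have h0 : 0 < p + t / 3 := by positivity
    have h1 : 0 < 1 - (p + t / 3) := by linarith
    have hne : 2 * ((p + t / 3) * (1 - (p + t / 3))) ≠ 0 := by positivity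
    have hdiv : ContinuousAt
        (fun s : ℝ => s ^ 2 / (2 * ((p + s / 3) * (1 - (p + s / 3))))) t :=
      ContinuousAt.div (by fun_prop) (by fun_prop) hne
    exact ENNReal.continuous_ofReal.continuousAt.comp
      (Real.continuous_exp.continuousAt.comp (continuousAt_const.mul hdiv).neg)
  refine ge_of_tendsto (hcont.tendsto.mono_left (nhdsWithin_le_nhds (s := Set.Iio t))) ?_
  filter_upwards [Ioo_mem_nhdsLT ht] with s hs
  have hbound : m * (p + s) ≤ ((j : ℕ) + 1 : ℝ) :=
    (mul_le_mul_of_nonneg_left (by linarith [hs.2]) hm.le).trans htj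
  refine (measure_orderStat_le_exp_bernoulliEntropy j hp (by linarith [hs.1])
    (by linarith [hs.2]) hbound).trans (ENNReal.ofReal_le_ofReal (Real.exp_le_exp.mpr ?_))
  exact neg_le_neg (mul_le_mul_of_nonneg_left
    (sq_div_le_bernoulliEntropy hp hs.1.le (by linarith [hs.2])) hm.le)

/-- The key tail bound in the proof of Theorem 2: if `ε = sqrt(ln(2/δ)/(2m))` and
`j ∈ {1,…,m}` satisfies `1 - α + ε ≤ j/m ≤ 1 - α + ε + 1/m`, then the `j`-th order
statistic of `m` i.i.d. standard uniform random variables (coordinates of the product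
of the uniform measure on `[0,1]`) satisfies
`P(U_{(j)} ≤ 1 - α) ≤ κ^DKW_{α,δ}`. -/
theorem uniform_order_statistic_tail_bound
    (m : ℕ) (hm : 1 ≤ m) (α δ : ℝ)
    (hα : α ∈ Set.Ioo (0 : ℝ) 1) (hδ : δ ∈ Set.Ioo (0 : ℝ) 1)
    (ε : ℝ) (hε : ε = Real.sqrt (Real.log (2 / δ) / (2 * m)))
    (j : ℕ) (hj : j ∈ Finset.Icc 1 m)
    (hjge : 1 - α + ε ≤ (j : ℝ) / m)
    (hjle : (j : ℝ) / m ≤ 1 - α + ε + 1 / m) :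
    (Measure.pi fun _ : Fin m => volume.restrict (Set.Icc (0 : ℝ) 1))
        {v : Fin m → ℝ |
          orderStat v ⟨j - 1, by have := Finset.mem_Icc.mp hj; omega⟩ ≤ 1 - α}
      ≤ ENNReal.ofReal (kappaDKW m α δ) := by
  obtain ⟨hα0, hα1⟩ := hα
  obtain ⟨hδ0, hδ1⟩ := hδ
  obtain ⟨hj1, hjm⟩ := Finset.mem_Icc.mp hj
  have hm0 : (0 : ℝ) < m := by exact_mod_cast hm
  have hδ2 : 0 < δ / 2 := by linarith
  have hL : 0 < Real.log (2 / δ) := Real.log_pos ((one_lt_div hδ0).mpr (by linarith))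
  have hlog : Real.log (δ / 2) = -Real.log (2 / δ) := by rw [← Real.log_inv, inv_div]
  have hε0 : 0 < ε := hε ▸ Real.sqrt_pos.mpr (by positivity)
  have hεsq : Real.log (2 / δ) = 2 * m * ε ^ 2 := by
    rw [hε, Real.sq_sqrt (by positivity)]
    field_simp
  have hΔ : ε / 3 ≤ deltaDKW m δ := by
    have hsqrt : ε / 3 ≤ Real.sqrt (2 * Real.log (2 / δ) / (9 * m)) := by
      apply Real.le_sqrt_of_sq_le
      rw [hεsq, le_div_iff₀ (by positivity)]
      nlinarith [mul_pos hm0 (pow_pos hε0 2)]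
    have : 0 ≤ 1 / (3 * (m : ℝ)) := by positivity
    rw [deltaDKW]
    linarith
  have hjcast : ((j - 1 : ℕ) + 1 : ℝ) = j := by
    rw [Nat.cast_sub hj1]
    ring
  have htj : m * (1 - α + ε) ≤ ((j - 1 : ℕ) + 1 : ℝ) := by
    rw [hjcast, mul_comm]
    exact (le_div_iff₀ hm0).mp hjge
  have hpε : 1 - α + ε ≤ 1 := hjge.trans ((div_le_one hm0).mpr (by exact_mod_cast hjm))
  refine (measure_orderStat_le_exp_sq _ (by linarith) hε0 htj).trans
    (ENNReal.ofReal_le_ofReal ?_)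
  set c := 1 - α + ε / 3 with hc
  have hcpos : 0 < c * (1 - c) := mul_pos (by linarith) (by linarith)
  have hcompare : ∀ y : ℝ, 4 * (c * (1 - c)) ≤ y →
      Real.exp (-(m * (ε ^ 2 / (2 * (c * (1 - c)))))) ≤ (δ / 2) ^ y⁻¹ := by
    intro y hy
    have hy0 : 0 < y := by linarith
    rw [Real.rpow_def_of_pos hδ2, Real.exp_le_exp, hlog, hεsq, neg_mul, neg_le_neg_iff,
      ← div_eq_mul_inv]
    calc 2 * m * ε ^ 2 / y ≤ 2 * m * ε ^ 2 / (4 * (c * (1 - c))) :=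
          div_le_div_of_nonneg_left (by positivity) (by positivity) hy
      _ = m * (ε ^ 2 / (2 * (c * (1 - c)))) := by
          field_simp
          ring
  rw [kappaDKW]
  split_ifs with h1 h2
  · apply hcompare
    nlinarith
  · simpa using hcompare 1 (by nlinarith [sq_nonneg (1 - 2 * c)])
  · apply hcompare
    nlinarith
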